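/- Let p>1, Q>1 and set p1 = -1/(p-1). Let q satisfy 1 ≤ q < 1/s⁺_{p1}(Q). Then there is a constant C = C(p,q,Q), independent of the dimension n and of the measure μ, such that: for every n ≥ 1, every Radon measure μ on ℝⁿ with μ(H) = 0 for every hyperplane H orthogonal to one of the coordinate axes, and every weight w with strong Muckenhoupt characteristic [w]_p ≤ Q, one has the strong Reverse Hölder bound [w]_{RH_q} ≤ C, i.e. ⟨w^q⟩_R^{1/q} ≤ C ⟨w⟩_R for every axis-parallel rectangular box R; in particular w belongs to the strong Reverse Hölder class RH_q* with respect to μ. -/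

import Mathlib

open MeasureTheory Set Filter

noncomputable section

/-- An axis-parallel open rectangular box in `ℝⁿ` (modelled as `Fin n → ℝ`). -/
def IsBox {n : ℕ} (R : Set (Fin n → ℝ)) : Prop :=
  ∃ a b : Fin n → ℝ, (∀ i, a i < b i) ∧ R = univ.pi fun i => Ioo (a i) (b i)

/-- The average `⟨f⟩_R = (1/μ(R)) ∫_R f dμ`. -/
def boxAvg {n : ℕ} (μ : Measure (Fin n → ℝ)) (R : Set (Fin n → ℝ))
    (f : (Fin n → ℝ) → ℝ) : ℝ :=
  ⨍ x in R, f x ∂μ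

/-- Every hyperplane orthogonal to one of the coordinate axes is `μ`-null. -/
def NullHyperplanes {n : ℕ} (μ : Measure (Fin n → ℝ)) : Prop :=
  ∀ (i : Fin n) (c : ℝ), μ {x | x i = c} = 0

/-- `[w]_p ≤ Q`: the strong Muckenhoupt characteristic of `w` w.r.t. `μ` is at most `Q`;
this includes the requisite integrability of `w` and `w^{-1/(p-1)}` on every box. -/
def ApBound {n : ℕ} (μ : Measure (Fin n → ℝ)) (w : (Fin n → ℝ) → ℝ) (p Q : ℝ) : Prop :=
  ∀ R : Set (Fin n → ℝ), IsBox R → 0 < μ R → μ R < ⊤ →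
    IntegrableOn w R μ ∧ IntegrableOn (fun x => w x ^ (-1 / (p - 1))) R μ ∧
    boxAvg μ R w * (boxAvg μ R fun x => w x ^ (-1 / (p - 1))) ^ (p - 1) ≤ Q

/-- `[w]_{RH_p} ≤ Q`: the strong Reverse Hölder characteristic of `w` w.r.t. `μ` is
at most `Q`, i.e. `⟨w^p⟩_R^{1/p} ≤ Q⟨w⟩_R` on every box. -/
def RHBound {n : ℕ} (μ : Measure (Fin n → ℝ)) (w : (Fin n → ℝ) → ℝ) (p Q : ℝ) : Prop :=
  ∀ R : Set (Fin n → ℝ), IsBox R → 0 < μ R → μ R < ⊤ →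
    IntegrableOn w R μ ∧ IntegrableOn (fun x => w x ^ p) R μ ∧
    (boxAvg μ R fun x => w x ^ p) ^ (1 / p) ≤ Q * boxAvg μ R w


section
variable {n : ℕ}

/-- The open box with opposite corners `a` and `b`; it is empty unless `a i < b i` for all `i`. -/
def openBox (a b : Fin n → ℝ) : Set (Fin n → ℝ) := univ.pi fun i => Ioo (a i) (b i)

lemma measurableSet_openBox (a b : Fin n → ℝ) : MeasurableSet (openBox a b) :=
  MeasurableSet.univ_pi fun _ => measurableSet_Ioo

lemma isBox_openBox {a b : Fin n → ℝ} (h : ∀ i, a i < b i) : IsBox (openBox a b) :=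
  ⟨a, b, h, rfl⟩

lemma measure_openBox_lt_top (μ : Measure (Fin n → ℝ)) [IsLocallyFiniteMeasure μ]
    (a b : Fin n → ℝ) : μ (openBox a b) < ⊤ :=
  (measure_mono (pi_mono fun _ _ => Ioo_subset_Icc_self)).trans_lt
    (isCompact_univ_pi fun i => isCompact_Icc (a := a i) (b := b i)).measure_lt_top

lemma openBox_eq_empty {a b : Fin n → ℝ} {i : Fin n} (h : b i ≤ a i) : openBox a b = ∅ :=
  univ_pi_eq_empty (Ioo_eq_empty_of_le h)

lemma openBox_update_right {a b : Fin n → ℝ} {i : Fin n} {c : ℝ} (hc : c ≤ b i) :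
    openBox a (Function.update b i c) = openBox a b ∩ {x | x i < c} := by
  ext x
  simp only [openBox, mem_univ_pi, mem_Ioo, mem_inter_iff, mem_ofPred_eq]
  constructor
  · intro h
    have hi := (h i).2
    rw [Function.update_self] at hi
    refine ⟨fun j => ⟨(h j).1, ?_⟩, hi⟩
    by_cases hj : j = i
    · subst hj; exact hi.trans_le hc
    · simpa [hj] using (h j).2
  · rintro ⟨h, hi⟩ j
    refine ⟨(h j).1, ?_⟩
    by_cases hj : j = i
    · subst hj; simpa using hi
    · simpa [hj] using (h j).2

lemma openBox_update_left {a b : Fin n → ℝ} {i : Fin n} {c : ℝ} (hc : a i ≤ c) :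
    openBox (Function.update a i c) b = openBox a b ∩ {x | c < x i} := by
  ext x
  simp only [openBox, mem_univ_pi, mem_Ioo, mem_inter_iff, mem_ofPred_eq]
  constructor
  · intro h
    have hi := (h i).1
    rw [Function.update_self] at hi
    refine ⟨fun j => ⟨?_, (h j).2⟩, hi⟩
    by_cases hj : j = i
    · subst hj; exact hc.trans_lt hi
    · simpa [hj] using (h j).1
  · rintro ⟨h, hi⟩ j
    refine ⟨?_, (h j).2⟩
    by_cases hj : j = i
    · subst hj; simpa using hi
    · simpa [hj] using (h j).1

lemma setIntegral_openBox_split {μ : Measure (Fin n → ℝ)} (hμ : NullHyperplanes μ)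
    {f : (Fin n → ℝ) → ℝ} {a b : Fin n → ℝ} (hf : IntegrableOn f (openBox a b) μ)
    {i : Fin n} {c : ℝ} (hac : a i ≤ c) (hcb : c ≤ b i) :
    ∫ x in openBox a b, f x ∂μ = ∫ x in openBox a (Function.update b i c), f x ∂μ +
      ∫ x in openBox (Function.update a i c) b, f x ∂μ := by
  rw [openBox_update_right hcb, openBox_update_left hac, ← setIntegral_union]
  · refine setIntegral_congr_set ?_
    rw [← inter_union_distrib_left]
    have h : ∀ᵐ x ∂μ, x i ≠ c := measure_mono_null (by intro x; simp) (hμ i c)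
    filter_upwards [h] with x hx
    refine propext ⟨fun h => ⟨h, lt_or_gt_of_ne hx⟩, fun h => h.1⟩
  · refine disjoint_left.2 fun x hx hx' => ?_
    exact lt_asymm (show x i < c from hx.2) hx'.2
  · exact (measurableSet_openBox a b).inter (measurableSet_lt measurable_const (measurable_pi_apply i))
  · exact hf.mono_set inter_subset_left
  · exact hf.mono_set inter_subset_left

lemma continuousOn_setIntegral_openBox_update {μ : Measure (Fin n → ℝ)} (hμ : NullHyperplanes μ)
    {f : (Fin n → ℝ) → ℝ} {a b : Fin n → ℝ} (hf : IntegrableOn f (openBox a b) μ) (i : Fin n) :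
    ContinuousOn (fun c => ∫ x in openBox a (Function.update b i c), f x ∂μ) (Iic (b i)) := by
  have hS (c : ℝ) : MeasurableSet {x : Fin n → ℝ | x i < c} :=
    measurableSet_lt (measurable_pi_apply i) measurable_const
  have key : Continuous fun c => ∫ x in openBox a b, {x | x i < c}.indicator f x ∂μ := by
    refine continuous_iff_continuousAt.2 fun c => ?_
    refine continuousAt_of_dominated (bound := fun x => ‖f x‖)
      (Eventually.of_forall fun t => hf.aestronglyMeasurable.indicator (hS t))
      (Eventually.of_forall fun t => Eventually.of_forall fun x => norm_indicator_le_norm_self f x)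
      hf.norm ?_
    have h : ∀ᵐ x ∂μ, x i ≠ c := measure_mono_null (by intro x; simp) (hμ i c)
    filter_upwards [ae_restrict_of_ae h] with x hx
    rcases lt_or_gt_of_ne hx with hx | hx
    · refine (continuousAt_const (y := f x)).congr ?_
      filter_upwards [lt_mem_nhds hx] with t ht
      simp [indicator, ht]
    · refine (continuousAt_const (y := (0 : ℝ))).congr ?_
      filter_upwards [gt_mem_nhds hx] with t ht
      simp [indicator, ht.le]
  refine key.continuousOn.congr fun c hc => ?_
  simp only [openBox_update_right (mem_Iic.1 hc)]
  rw [setIntegral_indicator (hS c)]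

lemma exists_halving_cut {μ : Measure (Fin n → ℝ)} (hμ : NullHyperplanes μ)
    {f : (Fin n → ℝ) → ℝ} {a b : Fin n → ℝ} (hf : IntegrableOn f (openBox a b) μ)
    (hfab : ∫ x in openBox a b, f x ∂μ ≤ 0) {i : Fin n} (hi : a i ≤ b i) :
    ∃ c ∈ Icc (a i) (b i),
      (∫ x in openBox a (Function.update b i c), f x ∂μ ≤ 0 ∧ c - a i ≤ (b i - a i) / 2 ∨
        ∫ x in openBox a (Function.update b i c), f x ∂μ = 0) ∧
      (∫ x in openBox (Function.update a i c) b, f x ∂μ ≤ 0 ∧ b i - c ≤ (b i - a i) / 2 ∨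
        ∫ x in openBox (Function.update a i c) b, f x ∂μ = 0) := by
  set H : ℝ → ℝ := fun c => ∫ x in openBox a (Function.update b i c), f x ∂μ with hH
  set m := (a i + b i) / 2 with hm
  have hcont : ContinuousOn H (Iic (b i)) := continuousOn_setIntegral_openBox_update hμ hf i
  have hHa : H (a i) = 0 := by
    have : openBox a (Function.update b i (a i)) = ∅ := openBox_eq_empty (i := i) (by simp)
    simp [hH, this]
  have hHb : H (b i) = ∫ x in openBox a b, f x ∂μ := by simp [hH]
  have hadd {c : ℝ} (hc : c ∈ Icc (a i) (b i)) :
      ∫ x in openBox (Function.update a i c) b, f x ∂μ = H (b i) - H c := by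
    rw [hHb, setIntegral_openBox_split hμ hf hc.1 hc.2]; simp [hH]
  have hmem : m ∈ Icc (a i) (b i) := ⟨by linarith, by linarith⟩
  rcases lt_or_ge 0 (H m) with h1 | h1
  · obtain ⟨c, hc, hc0⟩ : (0 : ℝ) ∈ H '' Icc m (b i) :=
      intermediate_value_Icc' hmem.2 (hcont.mono Icc_subset_Iic_self) ⟨by linarith, h1.le⟩
    have hc' : c ∈ Icc (a i) (b i) := ⟨hmem.1.trans hc.1, hc.2⟩
    refine ⟨c, hc', Or.inr hc0, Or.inl ⟨?_, by linarith [hc.1]⟩⟩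
    rw [hadd hc']; linarith
  rcases le_or_gt (H (b i) - H m) 0 with h2 | h2
  · refine ⟨m, hmem, Or.inl ⟨h1, by linarith⟩, Or.inl ⟨?_, by linarith⟩⟩
    rwa [hadd hmem]
  · obtain ⟨c, hc, hc0⟩ : H (b i) ∈ H '' Icc (a i) m :=
      intermediate_value_Icc' hmem.1
        (hcont.mono fun x hx => hx.2.trans hmem.2) ⟨by linarith, by linarith⟩
    have hc' : c ∈ Icc (a i) (b i) := ⟨hc.1, hc.2.trans hmem.2⟩
    refine ⟨c, hc', Or.inl ⟨?_, by linarith [hc.2]⟩, Or.inr ?_⟩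
    · change H c ≤ 0
      linarith
    · rw [hadd hc']; linarith

/-- Rising-sun type induction on boxes: a box on which `f` has nonpositive integral splits, up to
a null set, into boxes on which the integral of `f` vanishes and arbitrarily small boxes on which
it is nonpositive. -/
lemma setIntegral_openBox_nonneg_of_small_or_zero {μ : Measure (Fin n → ℝ)}
    (hμ : NullHyperplanes μ) {f Φ : (Fin n → ℝ) → ℝ}
    (hf : ∀ a b, IntegrableOn f (openBox a b) μ) (hΦ : ∀ a b, IntegrableOn Φ (openBox a b) μ)
    (hzero : ∀ a b, ∫ x in openBox a b, f x ∂μ = 0 → 0 ≤ ∫ x in openBox a b, Φ x ∂μ)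
    {δ : ℝ} (hδ : 0 < δ)
    (hsmall : ∀ a b, (∀ i, b i - a i ≤ δ) → ∫ x in openBox a b, f x ∂μ ≤ 0 →
      0 ≤ ∫ x in openBox a b, Φ x ∂μ)
    (a b : Fin n → ℝ) (hab : ∫ x in openBox a b, f x ∂μ ≤ 0) :
    0 ≤ ∫ x in openBox a b, Φ x ∂μ := by
  have main : ∀ (N : ℕ) (k : Fin n → ℕ), ∑ i, k i = N → ∀ a b : Fin n → ℝ,
      (∀ i, b i - a i ≤ δ * 2 ^ k i) → ∫ x in openBox a b, f x ∂μ ≤ 0 →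
      0 ≤ ∫ x in openBox a b, Φ x ∂μ := by
    intro N
    induction N with
    | zero =>
      intro k hk a b hs h0
      refine hsmall a b (fun i => ?_) h0
      have : k i = 0 := by simpa using (Finset.sum_eq_zero_iff.1 hk) i (Finset.mem_univ i)
      simpa [this] using hs i
    | succ N ih =>
      intro k hk a b hs h0
      obtain ⟨i, hi⟩ : ∃ i, k i ≠ 0 := by
        by_contra! h
        simp [h] at hk
      rcases le_or_gt (b i) (a i) with hba | hba
      · simp [openBox_eq_empty hba]
      obtain ⟨l, hl⟩ := Nat.exists_eq_succ_of_ne_zero hi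
      have hsum : ∑ j, Function.update k i l j = N := by
        have h1 := Finset.sum_update_of_mem (Finset.mem_univ i) k l
        have h2 := Finset.add_sum_erase Finset.univ k (Finset.mem_univ i)
        rw [Finset.sdiff_singleton_eq_erase] at h1
        omega
      have hhalf {t : ℝ} (ht : t ≤ (b i - a i) / 2) : t ≤ δ * 2 ^ l := by
        have := hs i
        rw [hl, pow_succ] at this
        linarith
      obtain ⟨c, hc, hL, hR⟩ := exists_halving_cut hμ (hf a b) h0 hba.le
      rw [setIntegral_openBox_split hμ (hΦ a b) hc.1 hc.2]
      refine add_nonneg ?_ ?_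
      · rcases hL with ⟨h1, h2⟩ | h1
        · refine ih _ hsum _ _ (fun j => ?_) h1
          by_cases hj : j = i
          · subst hj; simpa using hhalf h2
          · simpa [hj] using hs j
        · exact hzero _ _ h1
      · rcases hR with ⟨h1, h2⟩ | h1
        · refine ih _ hsum _ _ (fun j => ?_) h1
          by_cases hj : j = i
          · subst hj; simpa using hhalf h2
          · simpa [hj] using hs j
        · exact hzero _ _ h1
  have hk : ∀ i, ∃ k : ℕ, b i - a i ≤ δ * 2 ^ k := fun i => by
    obtain ⟨k, hk⟩ := pow_unbounded_of_one_lt ((b i - a i) / δ) one_lt_two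
    exact ⟨k, by rw [div_lt_iff₀ hδ] at hk; linarith⟩
  choose k hk using hk
  exact main _ k rfl a b hk hab

end

section

lemma rpow_tangent_le {t u v : ℝ} (ht : t < 0) (hu : 0 < u) (hv : 0 < v) :
    u ^ t + t * (u ^ t / u) * (v - u) ≤ v ^ t := by
  have h1 : v ^ t = u ^ t * (v / u) ^ t := by
    rw [← Real.mul_rpow hu.le (div_pos hv hu).le, mul_div_cancel₀ _ hu.ne']
  have h2 : 1 + t * (v / u - 1) ≤ (v / u) ^ t := by
    rw [Real.rpow_def_of_pos (div_pos hv hu)]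
    have h3 := Real.add_one_le_exp (Real.log (v / u) * t)
    have h4 := Real.log_le_sub_one_of_pos (div_pos hv hu)
    nlinarith
  have h5 := mul_le_mul_of_nonneg_left h2 (Real.rpow_pos_of_pos hu t).le
  rw [h1]
  refine le_trans (le_of_eq ?_) h5
  field_simp

/-- The function whose mean over a union of boxes on which `w` has mean `λ` is nonnegative when
evaluated at `w / λ`. -/
def levelFun (t Z v : ℝ) : ℝ := Z * t * (v - 1) + Z - v ^ t

variable {t Z s : ℝ}

lemma levelFun_nonpos (ht : t < 0) (hZ : 1 ≤ Z) (hs0 : 0 < s) (hs1 : s < 1)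
    (hs : (1 - s) ^ t = Z * (1 - t * s)) {v : ℝ} (hv : 0 < v) (hvr : v ≤ 1 - s) :
    levelFun t Z v ≤ 0 := by
  have h := rpow_tangent_le ht (sub_pos.2 hs1) hv
  rw [hs] at h
  have hr : 0 < 1 - s := by linarith
  have key : Z * t * (v - 1) + Z - (Z * (1 - t * s) + t * (Z * (1 - t * s) / (1 - s)) * (v - (1 - s)))
      = (Z * (-t) * (s * (1 - t)) / (1 - s)) * (v - (1 - s)) := by
    field_simp
    ring
  have h2 : 0 ≤ Z * (-t) * (s * (1 - t)) / (1 - s) := by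
    have : 0 < -t := by linarith
    have : 0 < 1 - t := by linarith
    positivity
  have h3 := mul_nonpos_of_nonneg_of_nonpos h2 (sub_nonpos.2 hvr)
  unfold levelFun
  linarith

lemma levelFun_nonneg (ht : t < 0) (hZ : 1 ≤ Z) (hs1 : s < 1)
    (hs : (1 - s) ^ t = Z * (1 - t * s)) {v : ℝ} (hvr : 1 - s ≤ v) (hv1 : v ≤ 1) :
    0 ≤ levelFun t Z v := by
  have hv : 0 < v := by linarith
  have h1 := rpow_tangent_le ht hv (sub_pos.2 hs1)
  have h2 := rpow_tangent_le ht hv one_pos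
  rw [hs] at h1
  rw [Real.one_rpow] at h2
  unfold levelFun
  rcases le_total 0 (Z * t - t * (v ^ t / v)) with h | h
  · nlinarith
  · nlinarith

lemma mul_sub_one_le_levelFun (ht : t < 0) (hZ : 1 ≤ Z) {v : ℝ} (hv : 1 ≤ v) :
    Z * t * (v - 1) ≤ levelFun t Z v := by
  have := Real.rpow_le_one_of_one_le_of_nonpos hv ht.le
  unfold levelFun
  linarith

/-- A primitive in `l` of `l ^ (q - 1) * levelFun t Z (w / l)`. -/
def levelPrimitive (t Z q w l : ℝ) : ℝ :=
  Z * (1 - t) * (l ^ q / q) + Z * t * w * (l ^ (q - 1) / (q - 1)) -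
    w ^ t * (l ^ (q - t) / (q - t))

lemma rpow_mul_levelFun_eq {q w l : ℝ} (hw : 0 < w) (hl : 0 < l) :
    l ^ (q - 1) * levelFun t Z (w / l) =
      Z * (1 - t) * l ^ (q - 1) + Z * t * w * l ^ (q - 1 - 1) - w ^ t * l ^ (q - t - 1) := by
  unfold levelFun
  rw [Real.div_rpow hw.le hl.le, show q - t - 1 = (q - 1) - t by ring, Real.rpow_sub hl (q - 1) t,
    Real.rpow_sub_one hl.ne' (q - 1)]
  have := (Real.rpow_pos_of_pos hl t).ne'
  field_simp
  ring

lemma integral_rpow_mul_levelFun (ht : t < 0) {q w l T : ℝ} (hq : 1 < q) (hw : 0 < w) (hl : 0 < l)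
    (hlT : l ≤ T) :
    ∫ x in l..T, x ^ (q - 1) * levelFun t Z (w / x) =
      levelPrimitive t Z q w T - levelPrimitive t Z q w l := by
  have hpos : ∀ x ∈ uIcc l T, 0 < x := fun x hx => by
    rw [uIcc_of_le hlT] at hx
    exact hl.trans_le hx.1
  have hcongr : ∀ x ∈ uIcc l T, x ^ (q - 1) * levelFun t Z (w / x) =
      Z * (1 - t) * x ^ (q - 1) + Z * t * w * x ^ (q - 1 - 1) - w ^ t * x ^ (q - t - 1) :=
    fun x hx => rpow_mul_levelFun_eq hw (hpos x hx)
  rw [intervalIntegral.integral_congr hcongr]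
  have hpow (y : ℝ) (hy : y ≠ 0) (x : ℝ) (hx : 0 < x) :
      HasDerivAt (fun x : ℝ => x ^ y / y) (x ^ (y - 1)) x := by
    have := (Real.hasDerivAt_rpow_const (p := y) (Or.inl hx.ne')).div_const y
    rwa [mul_div_cancel_left₀ _ hy] at this
  refine intervalIntegral.integral_eq_sub_of_hasDerivAt (f := levelPrimitive t Z q w) ?_ ?_
  · intro x hx
    have hx := hpos x hx
    exact (((hpow q (by linarith) x hx).const_mul _).add
      ((hpow (q - 1) (by linarith) x hx).const_mul _)).sub
      ((hpow (q - t) (by linarith) x hx).const_mul _)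
  · refine ContinuousOn.intervalIntegrable fun x hx => ContinuousAt.continuousWithinAt ?_
    have hx := (hpos x hx).ne'
    have h (y : ℝ) : ContinuousAt (fun x : ℝ => x ^ y) x :=
      Real.continuousAt_rpow_const x y (Or.inl hx)
    exact ((continuousAt_const.mul (h _)).add (continuousAt_const.mul (h _))).sub
      (continuousAt_const.mul (h _))

/-- The constant in the bound `levelPrimitive_le`. -/
def levelConst (t Z s q : ℝ) : ℝ :=
  Z * (t * (t - 1)) * (1 - s * q) / (q * (q - 1) * (q - t))

lemma levelConst_pos (ht : t < 0) (hZ : 1 ≤ Z) {q : ℝ} (hq : 1 < q) (hsq : s * q < 1) :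
    0 < levelConst t Z s q := by
  have h1 : 0 < t * (t - 1) := mul_pos_of_neg_of_neg ht (by linarith)
  have h2 : 0 < 1 - s * q := by linarith
  have h3 : 0 < q - 1 := by linarith
  have h4 : 0 < q - t := by linarith
  unfold levelConst
  positivity

lemma levelPrimitive_le (ht : t < 0) (hZ : 1 ≤ Z) (hs1 : s < 1)
    (hs : (1 - s) ^ t = Z * (1 - t * s)) {q : ℝ} (hq : 1 < q) (hsq : s * q < 1) {w T : ℝ}
    (hT : 0 < T) (hw : (1 - s) * T ≤ w) :
    levelPrimitive t Z q w T ≤ -levelConst t Z s q * T ^ q := by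
  have hr : 0 < 1 - s := by linarith
  have hw0 : 0 < w := (mul_pos hr hT).trans_le hw
  have h3 : 0 < q - 1 := by linarith
  have h4 : 0 < q - t := by linarith
  have h0 : 0 < q := by linarith
  set v := w / T with hv
  have hvr : 1 - s ≤ v := by rwa [hv, le_div_iff₀ hT]
  have hwv : w = v * T := by rw [hv]; field_simp
  have hv0 : 0 < v := hr.trans_le hvr
  have hA : levelPrimitive t Z q w T =
      T ^ q * (Z * (1 - t) / q + Z * t * v / (q - 1) - v ^ t / (q - t)) := by
    unfold levelPrimitive
    rw [hwv, Real.mul_rpow hv0.le hT.le, Real.rpow_sub hT q t, Real.rpow_sub_one hT.ne' q]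
    have := (Real.rpow_pos_of_pos hT t).ne'
    field_simp
  have htan := rpow_tangent_le ht hr hv0
  rw [hs] at htan
  have hG : Z * (1 - t) / q + Z * t * v / (q - 1) - v ^ t / (q - t) ≤ -levelConst t Z s q := by
    have h5 : Z * (1 - t) / q + Z * t * v / (q - 1) -
        (Z * (1 - t * s) + t * (Z * (1 - t * s) / (1 - s)) * (v - (1 - s))) / (q - t) =
        -levelConst t Z s q +
          Z * t * ((1 - t) * (1 - s * q)) / ((1 - s) * (q - t) * (q - 1)) * (v - (1 - s)) := by
      unfold levelConst
      field_simp
      ring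
    have h6 : Z * t * ((1 - t) * (1 - s * q)) / ((1 - s) * (q - t) * (q - 1)) ≤ 0 := by
      have h7 : 0 < 1 - s * q := by linarith
      have h8 : 0 < 1 - t := by linarith
      refine div_nonpos_of_nonpos_of_nonneg ?_ (by positivity)
      exact mul_nonpos_of_nonpos_of_nonneg
        (mul_nonpos_of_nonneg_of_nonpos (by linarith) ht.le) (by positivity)
    have h9 := mul_nonpos_of_nonpos_of_nonneg h6 (sub_nonneg.2 hvr)
    have h10 := div_le_div_of_nonneg_right htan h4.le
    linarith
  rw [hA, mul_comm (-levelConst t Z s q)]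
  exact mul_le_mul_of_nonneg_left hG (Real.rpow_pos_of_pos hT q).le

lemma setIntegral_level_le (ht : t < 0) (hZ : 1 ≤ Z) (hs0 : 0 < s) (hs1 : s < 1)
    (hs : (1 - s) ^ t = Z * (1 - t * s)) {q : ℝ} (hq : 1 < q) (hsq : s * q < 1) {w l M : ℝ}
    (hw : 0 < w) (hl : 0 < l) (hlM : l ≤ M) :
    ∫ x in Ioc l M, (Iic (w / (1 - s))).indicator (fun x => x ^ (q - 1) * levelFun t Z (w / x)) x ≤
      -levelConst t Z s q * (if w ≤ (1 - s) * M then w ^ q else 0) +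
      ((levelConst t Z s q + -(Z * t) / (q - 1)) * l ^ (q - 1) * w +
        l ^ (q - t) / (q - t) * w ^ t) := by
  have hc := levelConst_pos ht hZ hq hsq
  have hr : 0 < 1 - s := by linarith
  have h3 : 0 < q - 1 := by linarith
  have h4 : 0 < q - t := by linarith
  have hlq := Real.rpow_pos_of_pos hl (q - 1)
  have hlt := Real.rpow_pos_of_pos hl (q - t)
  have hwt := Real.rpow_pos_of_pos hw t
  have hZt : 0 < -(Z * t) := by nlinarith
  have hA1 : 0 ≤ -(Z * t) / (q - 1) * l ^ (q - 1) * w := by positivity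
  have hA2 : 0 ≤ l ^ (q - t) / (q - t) * w ^ t := by positivity
  have hA3 : 0 ≤ levelConst t Z s q * (l ^ (q - 1) * w) := by positivity
  rw [setIntegral_indicator measurableSet_Iic, Ioc_inter_Iic]
  rcases le_or_gt (w / (1 - s)) l with h | h
  · rw [Ioc_eq_empty (by simp [h])]
    rw [div_le_iff₀ hr] at h
    have hwl : w ≤ l := by nlinarith
    rw [if_pos (by nlinarith)]
    have h5 : w ^ q ≤ l ^ (q - 1) * w := by
      have := Real.rpow_le_rpow hw.le hwl h3.le
      calc w ^ q = w ^ (q - 1) * w := by rw [← Real.rpow_add_one hw.ne', sub_add_cancel]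
        _ ≤ _ := by gcongr
    have h6 := mul_le_mul_of_nonneg_left h5 hc.le
    simp only [Measure.restrict_empty, integral_zero_measure]
    linarith
  · have hlT : l ≤ min M (w / (1 - s)) := le_min hlM h.le
    have hT : 0 < min M (w / (1 - s)) := hl.trans_le hlT
    rw [← intervalIntegral.integral_of_le hlT, integral_rpow_mul_levelFun ht hq hw hl hlT]
    have hwT : (1 - s) * min M (w / (1 - s)) ≤ w := by
      rw [← le_div_iff₀' hr]
      exact min_le_right _ _
    have h1 := levelPrimitive_le ht hZ hs1 hs hq hsq hT hwT
    have h2 : -levelConst t Z s q * min M (w / (1 - s)) ^ q ≤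
        -levelConst t Z s q * (if w ≤ (1 - s) * M then w ^ q else 0) := by
      refine mul_le_mul_of_nonpos_left ?_ (by linarith)
      split_ifs with h7
      · rw [min_eq_right (by rwa [div_le_iff₀' hr])]
        refine Real.rpow_le_rpow hw.le ?_ (by linarith)
        rw [le_div_iff₀ hr]
        nlinarith
      · positivity
    have h5 : -levelPrimitive t Z q w l ≤
        -(Z * t) / (q - 1) * l ^ (q - 1) * w + l ^ (q - t) / (q - t) * w ^ t := by
      have h6 : 0 ≤ Z * (1 - t) * (l ^ q / q) := by
        have : 0 < 1 - t := by linarith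
        positivity
      unfold levelPrimitive
      have h7 : -(Z * t) / (q - 1) * l ^ (q - 1) * w = -(Z * t * w * (l ^ (q - 1) / (q - 1))) := by
        ring
      rw [h7]
      linarith [mul_div_assoc' (w ^ t) (l ^ (q - t)) (q - t), mul_comm (w ^ t) (l ^ (q - t) / (q - t))]
    linarith

end

section

variable {n : ℕ} {μ : Measure (Fin n → ℝ)} [IsLocallyFiniteMeasure μ] {w : (Fin n → ℝ) → ℝ}
  {t Z s : ℝ}

lemma levelFun_div_eq {x l : ℝ} (hx : 0 < x) (hl : 0 < l) :
    levelFun t Z (x / l) = Z * t / l * (x - l) + Z - (l ^ t)⁻¹ * x ^ t := by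
  unfold levelFun
  rw [Real.div_rpow hx.le hl.le]
  field_simp

lemma integrableOn_const_openBox (c : ℝ) (a b : Fin n → ℝ) :
    IntegrableOn (fun _ => c) (openBox a b) μ :=
  integrableOn_const (measure_openBox_lt_top μ a b).ne

lemma integrableOn_levelFun (hw0 : ∀ᵐ x ∂μ, 0 < w x) {a b : Fin n → ℝ}
    (hwi : IntegrableOn w (openBox a b) μ)
    (hwti : IntegrableOn (fun x => w x ^ t) (openBox a b) μ) {l : ℝ} (hl : 0 < l) :
    IntegrableOn (fun x => levelFun t Z (w x / l)) (openBox a b) μ := by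
  have h : IntegrableOn (fun x => Z * t / l * (w x - l) + Z - (l ^ t)⁻¹ * w x ^ t)
      (openBox a b) μ :=
    (((hwi.sub (integrableOn_const_openBox l a b)).const_mul _).add
      (integrableOn_const_openBox Z a b)).sub (hwti.const_mul _)
  refine h.congr ?_
  filter_upwards [ae_restrict_of_ae hw0] with x hx
  exact (levelFun_div_eq hx hl).symm

lemma setIntegral_levelFun_nonneg (hw0 : ∀ᵐ x ∂μ, 0 < w x) {a b : Fin n → ℝ}
    (hwi : IntegrableOn w (openBox a b) μ)
    (hwti : IntegrableOn (fun x => w x ^ t) (openBox a b) μ) {l : ℝ} (hl : 0 < l)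
    (hab : ∫ x in openBox a b, (w x - l) ∂μ = 0)
    (hA : ∫ x in openBox a b, w x ^ t ∂μ ≤ Z * l ^ t * μ.real (openBox a b)) :
    0 ≤ ∫ x in openBox a b, levelFun t Z (w x / l) ∂μ := by
  have hc := fun c => integrableOn_const_openBox (μ := μ) c a b
  have h1 : ∫ x in openBox a b, levelFun t Z (w x / l) ∂μ =
      ∫ x in openBox a b, (Z * t / l * (w x - l) + Z - (l ^ t)⁻¹ * w x ^ t) ∂μ := by
    refine integral_congr_ae ?_
    filter_upwards [ae_restrict_of_ae hw0] with x hx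
    exact levelFun_div_eq hx hl
  have hi1 : IntegrableOn (fun x => Z * t / l * (w x - l)) (openBox a b) μ :=
    (hwi.sub (hc l)).const_mul _
  have hi2 : IntegrableOn (fun x => Z * t / l * (w x - l) + Z) (openBox a b) μ := hi1.add (hc Z)
  rw [h1, integral_sub hi2 (hwti.const_mul _), integral_add hi1 (hc Z),
    integral_const_mul, integral_const_mul, hab]
  have hlt := Real.rpow_pos_of_pos hl t
  have h2 := mul_le_mul_of_nonneg_left hA (inv_pos.2 hlt).le
  have h3 : (l ^ t)⁻¹ * (Z * l ^ t * μ.real (openBox a b)) = Z * μ.real (openBox a b) := by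
    field_simp
  simp only [setIntegral_const, smul_eq_mul, mul_zero, zero_add]
  linarith

lemma setIntegral_indicator_levelFun_nonneg (hμ : NullHyperplanes μ) (hwm : Measurable w)
    (hw0 : ∀ᵐ x ∂μ, 0 < w x)
    (hwi : ∀ a b, IntegrableOn w (openBox a b) μ)
    (hwti : ∀ a b, IntegrableOn (fun x => w x ^ t) (openBox a b) μ)
    (ht : t < 0) (hZ : 1 ≤ Z) (hs0 : 0 < s) (hs1 : s < 1)
    (hs : (1 - s) ^ t = Z * (1 - t * s)) {l : ℝ} (hl : 0 < l)
    (hA : ∀ a b, ∫ x in openBox a b, (w x - l) ∂μ = 0 →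
      ∫ x in openBox a b, w x ^ t ∂μ ≤ Z * l ^ t * μ.real (openBox a b))
    (a b : Fin n → ℝ) (hab : ∫ x in openBox a b, (w x - l) ∂μ ≤ 0) :
    0 ≤ ∫ x in openBox a b,
      {x | (1 - s) * l ≤ w x}.indicator (fun x => levelFun t Z (w x / l)) x ∂μ := by
  set h : (Fin n → ℝ) → ℝ := {x | (1 - s) * l ≤ w x}.indicator fun x => levelFun t Z (w x / l)
    with h_def
  have hr : 0 < 1 - s := by linarith
  have hS : MeasurableSet {x | (1 - s) * l ≤ w x} := measurableSet_le measurable_const hwm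
  have hhi : ∀ a b, IntegrableOn h (openBox a b) μ := fun a b =>
    (integrableOn_levelFun hw0 (hwi a b) (hwti a b) hl).indicator hS
  have hhψ : ∀ x, 0 < w x → levelFun t Z (w x / l) ≤ h x := fun x hx => by
    by_cases hx' : (1 - s) * l ≤ w x
    · rw [h_def, indicator_of_mem (by exact hx')]
    · rw [h_def, indicator_of_notMem (by exact hx')]
      refine levelFun_nonpos ht hZ hs0 hs1 hs (div_pos hx hl) ?_
      rw [div_le_iff₀ hl]
      exact (not_le.1 hx').le
  set K := -(Z * t) / l with hK
  have hK0 : 0 < K := div_pos (by nlinarith) hl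
  have hhK1 : ∀ x, l ≤ w x → -K * (w x - l) ≤ h x := fun x hx => by
    have hx0 : 0 < w x := hl.trans_le hx
    refine le_trans ?_ (hhψ x hx0)
    refine le_trans (le_of_eq ?_) (mul_sub_one_le_levelFun ht hZ ((one_le_div hl).2 hx))
    rw [hK]
    field_simp
  have hhK2 : ∀ x, w x ≤ l → 0 ≤ h x := fun x hx => by
    refine indicator_apply_nonneg fun hx' => ?_
    refine levelFun_nonneg ht hZ hs1 hs ?_ ((div_le_one hl).2 hx)
    rw [le_div_iff₀ hl]
    exact hx'
  have hfi : ∀ a b, IntegrableOn (fun x => w x - l) (openBox a b) μ := fun a b =>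
    (hwi a b).sub (integrableOn_const_openBox l a b)
  have key : ∀ ε > 0, -(K * (2 + μ.real (openBox a b))) * ε ≤ ∫ x in openBox a b, h x ∂μ := by
    intro ε hε
    have : IsFiniteMeasure (μ.restrict (openBox a b)) :=
      ⟨by simpa using measure_openBox_lt_top μ a b⟩
    obtain ⟨g, hgc, hgε, hg, hgi⟩ :=
      (show Integrable w (μ.restrict (openBox a b)) from hwi a b).exists_hasCompactSupport_integral_sub_le
        hε
    have hgu := hgc.uniformContinuous_of_continuous hg
    obtain ⟨δ, hδ, hgδ⟩ := Metric.uniformContinuous_iff.1 hgu ε hε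
    have hgi' : ∀ a b, IntegrableOn g (openBox a b) μ := fun a b =>
      (hg.integrable_of_hasCompactSupport hgc).integrableOn
    have hdi : ∀ a b, IntegrableOn (fun x => ‖w x - g x‖) (openBox a b) μ := fun a b =>
      ((hwi a b).sub (hgi' a b)).norm
    have hei : ∀ a b, IntegrableOn (fun x => K * (2 * ‖w x - g x‖ + ε)) (openBox a b) μ :=
      fun a b => (((hdi a b).const_mul 2).add (integrableOn_const_openBox ε a b)).const_mul K
    have hΦ := setIntegral_openBox_nonneg_of_small_or_zero hμ hfi
      (Φ := fun x => h x + K * (2 * ‖w x - g x‖ + ε)) (fun a b => (hhi a b).add (hei a b))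
      (δ := δ / 2) ?_ (half_pos hδ) ?_ a b hab
    · rw [integral_add (hhi a b) (hei a b), integral_const_mul,
        integral_add ((hdi a b).const_mul 2) (integrableOn_const_openBox ε a b),
        integral_const_mul] at hΦ
      simp only [setIntegral_const, smul_eq_mul] at hΦ
      have := mul_le_mul_of_nonneg_left hgε hK0.le
      linarith
    · intro a b h0
      rw [integral_add (hhi a b) (hei a b)]
      refine add_nonneg ?_ (integral_nonneg fun x => by positivity)
      refine (setIntegral_levelFun_nonneg hw0 (hwi a b) (hwti a b) hl h0 (hA a b h0)).trans ?_
      refine integral_mono_ae (integrableOn_levelFun hw0 (hwi a b) (hwti a b) hl) (hhi a b) ?_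
      filter_upwards [ae_restrict_of_ae hw0] with x hx using hhψ x hx
    · intro a b hside h0
      have hosc : ∀ x ∈ openBox a b, ∀ y ∈ openBox a b, g x ≤ g y + ε := fun x hx y hy => by
        have hxy : dist x y < δ := by
          refine lt_of_le_of_lt ((dist_pi_le_iff (half_pos hδ).le).2 fun i => ?_) (half_lt_self hδ)
          have h1 := hx i (mem_univ i)
          have h2 := hy i (mem_univ i)
          have h3 := hside i
          rw [Real.dist_eq, abs_le]
          constructor <;> linarith [h1.1, h1.2, h2.1, h2.2]
        have := hgδ hxy
        rw [Real.dist_eq] at this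
        linarith [(abs_lt.1 this).2]
      by_cases hgl : ∀ x ∈ openBox a b, g x ≤ l
      · refine setIntegral_nonneg (measurableSet_openBox a b) fun x hx => ?_
        have h1 := hgl x hx
        have h2 := le_abs_self (w x - g x)
        rw [Real.norm_eq_abs]
        rcases le_total l (w x) with h3 | h3
        · have h4 := hhK1 x h3
          nlinarith [abs_nonneg (w x - g x)]
        · have h4 := hhK2 x h3
          have : 0 ≤ K * (2 * |w x - g x| + ε) := by positivity
          linarith
      · push Not at hgl
        obtain ⟨y, hy, hgy⟩ := hgl
        have h1 : 0 ≤ ∫ x in openBox a b, -K * (w x - l) ∂μ := by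
          rw [integral_const_mul]
          exact mul_nonneg_of_nonpos_of_nonpos (by linarith) h0
        refine h1.trans (setIntegral_mono_on ((hfi a b).const_mul _) ((hhi a b).add (hei a b))
          (measurableSet_openBox a b) fun x hx => ?_)
        have h2 := hosc y hy x hx
        rw [Real.norm_eq_abs]
        have h3 := neg_abs_le (w x - g x)
        rcases le_total l (w x) with h4 | h4
        · have h5 := hhK1 x h4
          have : 0 ≤ K * (2 * |w x - g x| + ε) := by positivity
          linarith
        · have h5 := hhK2 x h4
          nlinarith [abs_nonneg (w x - g x)]
  by_contra hneg
  push Not at hneg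
  set I := ∫ x in openBox a b, h x ∂μ
  have hD : 0 < K * (2 + μ.real (openBox a b)) := by
    have : 0 ≤ μ.real (openBox a b) := measureReal_nonneg
    positivity
  have h1 := key (-I / (2 * (K * (2 + μ.real (openBox a b))))) (div_pos (by linarith) (by linarith))
  have h2 : -(K * (2 + μ.real (openBox a b))) * (-I / (2 * (K * (2 + μ.real (openBox a b))))) =
      I / 2 := by
    field_simp
  linarith

end

section

lemma integrableOn_rpow_Ioc {l M : ℝ} (hl : 0 < l) (y : ℝ) :
    IntegrableOn (fun x : ℝ => x ^ y) (Ioc l M) volume := by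
  have h : ContinuousOn (fun x : ℝ => x ^ y) (Icc l M) := fun x hx =>
    (Real.continuousAt_rpow_const x y (Or.inl (hl.trans_le hx.1).ne')).continuousWithinAt
  exact h.integrableOn_Icc.mono_set Ioc_subset_Icc_self

variable {n : ℕ} {μ : Measure (Fin n → ℝ)} [IsLocallyFiniteMeasure μ] {w : (Fin n → ℝ) → ℝ}
  {t Z s : ℝ}

lemma integral_setIntegral_level_nonneg (hμ : NullHyperplanes μ) (hwm : Measurable w)
    (hw0 : ∀ᵐ x ∂μ, 0 < w x)
    (hwi : ∀ a b, IntegrableOn w (openBox a b) μ)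
    (hwti : ∀ a b, IntegrableOn (fun x => w x ^ t) (openBox a b) μ)
    (ht : t < 0) (hZ : 1 ≤ Z) (hs0 : 0 < s) (hs1 : s < 1)
    (hs : (1 - s) ^ t = Z * (1 - t * s)) (q : ℝ)
    (hA : ∀ l > 0, ∀ a b, ∫ x in openBox a b, (w x - l) ∂μ = 0 →
      ∫ x in openBox a b, w x ^ t ∂μ ≤ Z * l ^ t * μ.real (openBox a b))
    {a b : Fin n → ℝ} {l M : ℝ} (hl : 0 < l) (hab : ∫ x in openBox a b, (w x - l) ∂μ = 0) :
    ∃ G : (Fin n → ℝ) → ℝ, IntegrableOn G (openBox a b) μ ∧ 0 ≤ ∫ x in openBox a b, G x ∂μ ∧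
      ∀ x, 0 < w x → G x = ∫ y in Ioc l M,
        (Iic (w x / (1 - s))).indicator (fun y => y ^ (q - 1) * levelFun t Z (w x / y)) y := by
  have hr : 0 < 1 - s := by linarith
  have : IsFiniteMeasure (μ.restrict (openBox a b)) :=
    ⟨by simpa using measure_openBox_lt_top μ a b⟩
  have hc := fun c => integrableOn_const_openBox (μ := μ) c a b
  let F : (Fin n → ℝ) → ℝ → ℝ := fun x y => {z : (Fin n → ℝ) × ℝ | (1 - s) * z.2 ≤ w z.1}.indicator
    (fun z => Z * (1 - t) * z.2 ^ (q - 1) + Z * t * w z.1 * z.2 ^ (q - 1 - 1) -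
      w z.1 ^ t * z.2 ^ (q - t - 1)) (x, y)
  have hF : Integrable (Function.uncurry F)
      ((μ.restrict (openBox a b)).prod (volume.restrict (Ioc l M))) := by
    refine Integrable.indicator ?_ (measurableSet_le (by fun_prop) (by fun_prop))
    exact (((hc (Z * (1 - t))).mul_prod (integrableOn_rpow_Ioc hl (q - 1))).add
      (((hwi a b).const_mul (Z * t)).mul_prod (integrableOn_rpow_Ioc hl (q - 1 - 1)))).sub
      ((hwti a b).mul_prod (integrableOn_rpow_Ioc hl (q - t - 1)))
  have hFeq : ∀ x, 0 < w x → ∀ y, 0 < y → F x y =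
      (Iic (w x / (1 - s))).indicator (fun y => y ^ (q - 1) * levelFun t Z (w x / y)) y := by
    intro x hx y hy
    by_cases h : (1 - s) * y ≤ w x
    · have h' : y ≤ w x / (1 - s) := (le_div_iff₀' hr).2 h
      simp only [F]
      rw [indicator_of_mem (by exact h), indicator_of_mem (by exact h'),
        rpow_mul_levelFun_eq hx hy]
    · have h' : ¬ y ≤ w x / (1 - s) := fun h' => h ((le_div_iff₀' hr).1 h')
      simp only [F]
      rw [indicator_of_notMem (by exact h), indicator_of_notMem (by exact h')]
  refine ⟨fun x => ∫ y in Ioc l M, F x y, hF.integral_prod_left, ?_, fun x hx => ?_⟩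
  · rw [integral_integral_swap hF]
    refine setIntegral_nonneg measurableSet_Ioc fun y hy => ?_
    have hy0 : 0 < y := hl.trans hy.1
    have h1 : ∫ x in openBox a b, F x y ∂μ = y ^ (q - 1) * ∫ x in openBox a b,
        {x | (1 - s) * y ≤ w x}.indicator (fun x => levelFun t Z (w x / y)) x ∂μ := by
      rw [← integral_const_mul]
      refine integral_congr_ae ?_
      filter_upwards [ae_restrict_of_ae hw0] with x hx
      rw [hFeq x hx y hy0]
      by_cases h : (1 - s) * y ≤ w x
      · have h' : y ≤ w x / (1 - s) := (le_div_iff₀' hr).2 h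
        rw [indicator_of_mem (by exact h'), indicator_of_mem (by exact h)]
      · have h' : ¬ y ≤ w x / (1 - s) := fun h' => h ((le_div_iff₀' hr).1 h')
        rw [indicator_of_notMem (by exact h'), indicator_of_notMem (by exact h), mul_zero]
    rw [h1]
    refine mul_nonneg (Real.rpow_nonneg hy0.le _) ?_
    refine setIntegral_indicator_levelFun_nonneg hμ hwm hw0 hwi hwti ht hZ hs0 hs1 hs hy0
      (hA y hy0) a b (le_trans ?_ hab.le)
    refine integral_mono ((hwi a b).sub (hc y)) ((hwi a b).sub (hc l)) fun x => ?_
    exact sub_le_sub_left hy.1.le _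
  · exact setIntegral_congr_fun measurableSet_Ioc fun y hy => hFeq x hx y (hl.trans hy.1)

lemma integrableOn_truncated_rpow (hwm : Measurable w) (hw0 : ∀ᵐ x ∂μ, 0 < w x) {q : ℝ}
    (hq : 0 ≤ q) (a b : Fin n → ℝ) (c : ℝ) :
    IntegrableOn (fun x => if w x ≤ c then w x ^ q else 0) (openBox a b) μ := by
  refine Integrable.mono' (integrableOn_const_openBox (|c| ^ q) a b) ?_ ?_
  · exact (Measurable.ite (measurableSet_le hwm measurable_const) (hwm.pow_const q)
      measurable_const).aestronglyMeasurable
  · filter_upwards [ae_restrict_of_ae hw0] with x hx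
    split_ifs with h
    · rw [Real.norm_of_nonneg (by positivity)]
      exact Real.rpow_le_rpow hx.le (h.trans (le_abs_self c)) hq
    · rw [norm_zero]
      positivity

/-- The constant in the truncated reverse Hölder inequality. -/
def reverseHolderConst (t Z s q : ℝ) : ℝ :=
  (levelConst t Z s q + -(Z * t) / (q - 1) + Z / (q - t)) / levelConst t Z s q

lemma setIntegral_truncated_rpow_le (hμ : NullHyperplanes μ) (hwm : Measurable w)
    (hw0 : ∀ᵐ x ∂μ, 0 < w x)
    (hwi : ∀ a b, IntegrableOn w (openBox a b) μ)
    (hwti : ∀ a b, IntegrableOn (fun x => w x ^ t) (openBox a b) μ)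
    (ht : t < 0) (hZ : 1 ≤ Z) (hs0 : 0 < s) (hs1 : s < 1)
    (hs : (1 - s) ^ t = Z * (1 - t * s)) {q : ℝ} (hq : 1 < q) (hsq : s * q < 1)
    (hA : ∀ l > 0, ∀ a b, ∫ x in openBox a b, (w x - l) ∂μ = 0 →
      ∫ x in openBox a b, w x ^ t ∂μ ≤ Z * l ^ t * μ.real (openBox a b))
    {a b : Fin n → ℝ} {l M : ℝ} (hl : 0 < l) (hlM : l ≤ M)
    (hab : ∫ x in openBox a b, (w x - l) ∂μ = 0) :
    ∫ x in openBox a b, (if w x ≤ (1 - s) * M then w x ^ q else 0) ∂μ ≤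
      reverseHolderConst t Z s q * l ^ q * μ.real (openBox a b) := by
  have hγ := levelConst_pos ht hZ hq hsq
  obtain ⟨G, hGi, hG0, hG⟩ := integral_setIntegral_level_nonneg (M := M) hμ hwm hw0 hwi hwti ht hZ
    hs0 hs1 hs q hA hl hab
  have hti := integrableOn_truncated_rpow hwm hw0 (by linarith : 0 ≤ q) a b ((1 - s) * M)
  have hwl : ∫ x in openBox a b, w x ∂μ = l * μ.real (openBox a b) := by
    rw [integral_sub (hwi a b) (integrableOn_const_openBox l a b)] at hab
    simp only [setIntegral_const, smul_eq_mul] at hab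
    linarith
  have hi2 : IntegrableOn (fun x => (levelConst t Z s q + -(Z * t) / (q - 1)) * l ^ (q - 1) * w x +
      l ^ (q - t) / (q - t) * w x ^ t) (openBox a b) μ :=
    ((hwi a b).const_mul _).add ((hwti a b).const_mul _)
  have h1 := integral_mono_ae hGi ((hti.const_mul (-levelConst t Z s q)).add hi2) <| by
    filter_upwards [ae_restrict_of_ae hw0] with x hx
    rw [hG x hx]
    exact setIntegral_level_le ht hZ hs0 hs1 hs hq hsq hx hl hlM
  simp only [Pi.add_apply] at h1
  rw [integral_add (hti.const_mul (-levelConst t Z s q)) hi2, integral_const_mul,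
    integral_add ((hwi a b).const_mul _) ((hwti a b).const_mul _), integral_const_mul,
    integral_const_mul, hwl] at h1
  have hqt : 0 < q - t := by linarith
  have h2 : l ^ (q - t) / (q - t) * ∫ x in openBox a b, w x ^ t ∂μ ≤
      Z / (q - t) * l ^ q * μ.real (openBox a b) := by
    refine (mul_le_mul_of_nonneg_left (hA l hl a b hab) (by positivity)).trans (le_of_eq ?_)
    rw [Real.rpow_sub hl]
    have := (Real.rpow_pos_of_pos hl t).ne'
    field_simp
  have h3 : l ^ (q - 1) * l = l ^ q := by rw [← Real.rpow_add_one hl.ne', sub_add_cancel]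
  have h4 : levelConst t Z s q *
      ∫ x in openBox a b, (if w x ≤ (1 - s) * M then w x ^ q else 0) ∂μ ≤
      (levelConst t Z s q + -(Z * t) / (q - 1) + Z / (q - t)) * l ^ q * μ.real (openBox a b) := by
    have h5 : (levelConst t Z s q + -(Z * t) / (q - 1)) * l ^ (q - 1) * (l * μ.real (openBox a b)) =
        (levelConst t Z s q + -(Z * t) / (q - 1)) * l ^ q * μ.real (openBox a b) := by
      rw [← h3]; ring
    rw [h5] at h1
    linarith
  unfold reverseHolderConst
  rw [div_mul_eq_mul_div, div_mul_eq_mul_div, le_div_iff₀ hγ]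
  linarith

lemma reverseHolderConst_pos (ht : t < 0) (hZ : 1 ≤ Z) {q : ℝ} (hq : 1 < q) (hsq : s * q < 1) :
    0 < reverseHolderConst t Z s q := by
  have hγ := levelConst_pos ht hZ hq hsq
  have h1 : 0 < -(Z * t) := by nlinarith
  have h2 : 0 < q - 1 := by linarith
  have h3 : 0 < q - t := by linarith
  unfold reverseHolderConst
  positivity

lemma integrableOn_rpow_and_setIntegral_le (hwm : Measurable w) (hw0 : ∀ᵐ x ∂μ, 0 < w x)
    {q : ℝ} (hq : 0 ≤ q) {a b : Fin n → ℝ} {c : ℕ → ℝ} (hc : Monotone c)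
    (hct : Tendsto c atTop atTop) {B : ℝ} (hB : 0 ≤ B)
    (h : ∀ k, ∫ x in openBox a b, (if w x ≤ c k then w x ^ q else 0) ∂μ ≤ B) :
    IntegrableOn (fun x => w x ^ q) (openBox a b) μ ∧ ∫ x in openBox a b, w x ^ q ∂μ ≤ B := by
  have hnn : ∀ᵐ x ∂μ.restrict (openBox a b), 0 ≤ w x ^ q := by
    filter_upwards [ae_restrict_of_ae hw0] with x hx using Real.rpow_nonneg hx.le q
  have hm : AEStronglyMeasurable (fun x => w x ^ q) (μ.restrict (openBox a b)) :=
    (hwm.pow_const q).aestronglyMeasurable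
  have hlim : Tendsto (fun k => ∫⁻ x in openBox a b,
      ENNReal.ofReal (if w x ≤ c k then w x ^ q else 0) ∂μ) atTop
      (nhds (∫⁻ x in openBox a b, ENNReal.ofReal (w x ^ q) ∂μ)) := by
    refine lintegral_tendsto_of_tendsto_of_monotone (fun k => ?_) ?_ ?_
    · exact (Measurable.ite (measurableSet_le hwm measurable_const) (hwm.pow_const q)
        measurable_const).ennreal_ofReal.aemeasurable
    · filter_upwards [hnn] with x hx i j hij
      refine ENNReal.ofReal_le_ofReal ?_
      have := hc hij
      split_ifs with h1 h2 h2
      · exact le_rfl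
      · exact absurd (h1.trans this) h2
      · exact hx
      · exact le_rfl
    · refine Eventually.of_forall fun x => tendsto_const_nhds.congr' ?_
      filter_upwards [hct.eventually_ge_atTop (w x)] with k hk
      rw [if_pos hk]
  have hle : ∫⁻ x in openBox a b, ENNReal.ofReal (w x ^ q) ∂μ ≤ ENNReal.ofReal B := by
    refine le_of_tendsto' hlim fun k => ?_
    rw [← ofReal_integral_eq_lintegral_ofReal (integrableOn_truncated_rpow hwm hw0 hq a b (c k))]
    · exact ENNReal.ofReal_le_ofReal (h k)
    · filter_upwards [hnn] with x hx
      change 0 ≤ if w x ≤ c k then w x ^ q else 0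
      split_ifs
      · exact hx
      · exact le_rfl
  refine ⟨(lintegral_ofReal_ne_top_iff_integrable hm hnn).1
    (hle.trans_lt ENNReal.ofReal_lt_top).ne, ?_⟩
  rw [integral_eq_lintegral_of_nonneg_ae hnn hm]
  exact ENNReal.toReal_le_of_le_ofReal hB hle

lemma ApBound.integrableOn {p Q : ℝ} (hA : ApBound μ w p Q) (a b : Fin n → ℝ) :
    IntegrableOn w (openBox a b) μ ∧
      IntegrableOn (fun x => w x ^ (-1 / (p - 1))) (openBox a b) μ := by
  rcases eq_or_ne (μ (openBox a b)) 0 with h0 | h0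
  · simp [IntegrableOn, Measure.restrict_eq_zero.2 h0]
  have hab : ∀ i, a i < b i := by
    by_contra! h
    obtain ⟨i, hi⟩ := h
    exact h0 (by simp [openBox_eq_empty hi])
  have := hA _ (isBox_openBox hab) (pos_iff_ne_zero.2 h0) (measure_openBox_lt_top μ a b)
  exact ⟨this.1, this.2.1⟩

lemma ApBound.setIntegral_rpow_le {p Q : ℝ} (hp : 1 < p) (hQ : 0 ≤ Q)
    (hw0 : ∀ᵐ x ∂μ, 0 < w x) (hA : ApBound μ w p Q) (a b : Fin n → ℝ) {l : ℝ} (hl : 0 < l)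
    (h : ∫ x in openBox a b, (w x - l) ∂μ = 0) :
    ∫ x in openBox a b, w x ^ (-1 / (p - 1)) ∂μ ≤
      Q ^ (1 / (p - 1)) * l ^ (-1 / (p - 1)) * μ.real (openBox a b) := by
  have hp' : 0 < p - 1 := by linarith
  rcases eq_or_ne (μ (openBox a b)) 0 with h0 | h0
  · simp [Measure.restrict_eq_zero.2 h0, measureReal_def, h0]
  have hab : ∀ i, a i < b i := by
    by_contra! h
    obtain ⟨i, hi⟩ := h
    exact h0 (by simp [openBox_eq_empty hi])
  have hfin := measure_openBox_lt_top μ a b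
  obtain ⟨hi, -, hle⟩ := hA _ (isBox_openBox hab) (pos_iff_ne_zero.2 h0) hfin
  have hm : 0 < μ.real (openBox a b) := ENNReal.toReal_pos h0 hfin.ne
  rw [integral_sub hi (integrableOn_const_openBox l a b)] at h
  simp only [setIntegral_const, smul_eq_mul] at h
  simp only [boxAvg, setAverage_eq, smul_eq_mul] at hle
  have hl' : (μ.real (openBox a b))⁻¹ * ∫ x in openBox a b, w x ∂μ = l := by
    rw [sub_eq_zero.1 h]
    field_simp
  rw [hl'] at hle
  set I := ∫ x in openBox a b, w x ^ (-1 / (p - 1)) ∂μ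
  have hI : 0 ≤ I := by
    refine integral_nonneg_of_ae ?_
    filter_upwards [ae_restrict_of_ae hw0] with x hx using Real.rpow_nonneg hx.le _
  have hG : 0 ≤ (μ.real (openBox a b))⁻¹ * I := by positivity
  have h1 : ((μ.real (openBox a b))⁻¹ * I) ^ (p - 1) ≤ Q / l := by
    rwa [le_div_iff₀' hl]
  have h2 := Real.rpow_le_rpow (by positivity) h1 (one_div_pos.2 hp').le
  rw [← Real.rpow_mul hG, mul_one_div_cancel hp'.ne', Real.rpow_one, Real.div_rpow hQ hl.le,
    inv_mul_le_iff₀ hm] at h2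
  refine h2.trans (le_of_eq ?_)
  rw [show -1 / (p - 1) = -(1 / (p - 1)) by ring, Real.rpow_neg hl.le]
  ring

end


/-- Self-improvement `A_p^* ⊂ RH_q^*` for `1 ≤ q < 1/s⁺_{p1}(Q)`, with a
constant independent of the dimension and of the measure. -/
theorem strong_Ap_self_improvement_to_RHq
    (p Q p1 : ℝ) (hp : 1 < p) (hQ : 1 < Q) (hp1 : p1 = -1 / (p - 1))
    (sp : ℝ) (hsp_mem : sp ∈ Icc (0:ℝ) 1)
    (hsp : (1 - sp) * (1 - p1 * sp) ^ (-1 / p1) = 1 / Q)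
    (q : ℝ) (hq1 : 1 ≤ q) (hq2 : q < 1 / sp) :
    ∃ C : ℝ, 0 < C ∧
      ∀ n : ℕ, 1 ≤ n →
        ∀ μ : Measure (Fin n → ℝ), IsLocallyFiniteMeasure μ → NullHyperplanes μ →
          ∀ w : (Fin n → ℝ) → ℝ, Measurable w → (∀ᵐ x ∂μ, 0 < w x) →
            ApBound μ w p Q → RHBound μ w q C := by
  rcases hq1.eq_or_lt with rfl | hq
  · refine ⟨1, one_pos, fun n _ μ _ _ w _ _ hA R hR h0 hfin => ?_⟩
    have hi := (hA R hR h0 hfin).1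
    simpa using hi
  have hp' : 0 < p - 1 := by linarith
  have hQ0 : 0 < Q := by linarith
  have ht : p1 < 0 := by
    rw [hp1]
    exact div_neg_of_neg_of_pos (by norm_num) hp'
  have hs1 : sp < 1 := by
    refine lt_of_le_of_ne hsp_mem.2 fun h => ?_
    rw [h, sub_self, zero_mul] at hsp
    exact (one_div_pos.2 hQ0).ne hsp
  have hs0 : 0 < sp := by
    refine lt_of_le_of_ne hsp_mem.1 fun h => ?_
    rw [← h] at hsp
    simp at hsp
    linarith
  have hr : 0 < 1 - sp := by linarith
  have hz : 0 < 1 - p1 * sp := by nlinarith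
  have hZ : 1 ≤ Q ^ (1 / (p - 1)) := Real.one_le_rpow hQ.le (one_div_pos.2 hp').le
  have hs : (1 - sp) ^ p1 = Q ^ (1 / (p - 1)) * (1 - p1 * sp) := by
    have h := congrArg (fun x => x ^ p1) hsp
    rw [Real.mul_rpow hr.le (by positivity), ← Real.rpow_mul hz.le, div_mul_cancel₀ _ ht.ne,
      Real.rpow_neg_one, one_div, Real.inv_rpow hQ0.le, ← Real.rpow_neg hQ0.le,
      mul_inv_eq_iff_eq_mul₀ hz.ne'] at h
    rw [h, hp1]
    congr 2
    ring
  have hsq : sp * q < 1 := by rwa [lt_div_iff₀' hs0] at hq2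
  set K := reverseHolderConst p1 (Q ^ (1 / (p - 1))) sp q with hK
  have hK0 : 0 < K := reverseHolderConst_pos ht hZ hq hsq
  refine ⟨K ^ (1 / q), by positivity, fun n _ μ _ hμ w hwm hw0 hA R hR h0 hfin => ?_⟩
  obtain ⟨a, b, hab, rfl⟩ := hR
  change 0 < μ (openBox a b) at h0
  change μ (openBox a b) < ⊤ at hfin
  change IntegrableOn w (openBox a b) μ ∧ IntegrableOn (fun x => w x ^ q) (openBox a b) μ ∧
    (boxAvg μ (openBox a b) fun x => w x ^ q) ^ (1 / q) ≤ K ^ (1 / q) * boxAvg μ (openBox a b) w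
  have hm : 0 < μ.real (openBox a b) := ENNReal.toReal_pos h0.ne' hfin.ne
  have hwi := fun a b => (hA.integrableOn a b).1
  set l := boxAvg μ (openBox a b) w with hl_def
  have hl_eq : ∫ x in openBox a b, w x ∂μ = l * μ.real (openBox a b) := by
    rw [hl_def, boxAvg, setAverage_eq, smul_eq_mul]
    field_simp
  have hl : 0 < l := by
    have hpos : 0 < ∫ x in openBox a b, w x ∂μ := by
      rw [setIntegral_pos_iff_support_of_nonneg_ae
        ((ae_restrict_of_ae hw0).mono fun x hx => hx.le) (hwi a b)]
      refine h0.trans_le (measure_mono_ae ?_)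
      filter_upwards [hw0] with x hx hxR
      exact ⟨hx.ne', hxR⟩
    rw [hl_eq] at hpos
    exact pos_of_mul_pos_left hpos hm.le
  have hl0 : ∫ x in openBox a b, (w x - l) ∂μ = 0 := by
    rw [integral_sub (hwi a b) (integrableOn_const_openBox l a b), hl_eq]
    simp only [setIntegral_const, smul_eq_mul]
    ring
  have hmain := integrableOn_rpow_and_setIntegral_le hwm hw0 (q := q) (by linarith)
    (a := a) (b := b) (c := fun k : ℕ => (1 - sp) * (l + k)) (B := K * l ^ q * μ.real (openBox a b))
    (fun i j hij => by
      have : (i : ℝ) ≤ j := by exact_mod_cast hij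
      exact mul_le_mul_of_nonneg_left (by linarith) hr.le)
    ((tendsto_atTop_add_const_left _ l tendsto_natCast_atTop_atTop).const_mul_atTop hr)
    (by positivity)
    (fun k => setIntegral_truncated_rpow_le hμ hwm hw0 hwi
      (fun a b => hp1 ▸ (hA.integrableOn a b).2) ht hZ hs0 hs1 hs hq hsq
      (fun y hy a b h => hp1 ▸ hA.setIntegral_rpow_le hp hQ0.le hw0 a b hy h) hl
      (by simp) hl0)
  refine ⟨hwi a b, hmain.1, ?_⟩
  have hle : (boxAvg μ (openBox a b) fun x => w x ^ q) ≤ K * l ^ q := by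
    rw [boxAvg, setAverage_eq, smul_eq_mul, inv_mul_le_iff₀ hm]
    linarith [hmain.2]
  have hnn : 0 ≤ boxAvg μ (openBox a b) fun x => w x ^ q := by
    rw [boxAvg, setAverage_eq, smul_eq_mul]
    refine mul_nonneg (inv_nonneg.2 hm.le) (integral_nonneg_of_ae ?_)
    filter_upwards [ae_restrict_of_ae hw0] with x hx using Real.rpow_nonneg hx.le q
  have hq0 : 0 < q := by linarith
  refine (Real.rpow_le_rpow hnn hle (one_div_pos.2 hq0).le).trans (le_of_eq ?_)
  rw [Real.mul_rpow hK0.le (by positivity), ← Real.rpow_mul hl.le, mul_one_div_cancel hq0.ne',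
    Real.rpow_one]
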